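/- In the polynomial ring ℂ[y₁,x₁,h₁,y₂,y₃,x₂,x₃,h₀], define I₁ = h₀, I₂ = h₁² + 4x₁y₁, I₃ = x₂y₂ + x₃y₃, I₄ = h₁y₂y₃ + y₁y₂² − x₁y₃², I₅ = h₁x₂x₃ + x₁x₂² − x₃²y₁, I₆ = h₁(x₂y₂ − x₃y₃) − 2(y₁y₂x₃ + x₁x₂y₃), and let R = ℂ[I₁,…,I₆] be the ℂ-subalgebra they generate. Then R admits the Hironaka decomposition R = ℂ[I₁,…,I₅] ⊕ I₆·ℂ[I₁,…,I₅] as a direct sum of ℂ-vector spaces: every element of R can be written uniquely in the form p(I₁,…,I₅) + I₆·q(I₁,…,I₅) with p, q polynomials over ℂ in five variables. In particular, I₁,…,I₅ are primary invariants and I₆ is a secondary invariant. -/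

import Mathlib

open MvPolynomial

/-- Variables: `0 ↦ y₁, 1 ↦ x₁, 2 ↦ h₁, 3 ↦ y₂, 4 ↦ y₃, 5 ↦ x₂, 6 ↦ x₃, 7 ↦ h₀`. -/
noncomputable abbrev y₁ : MvPolynomial (Fin 8) ℂ := X 0
noncomputable abbrev x₁ : MvPolynomial (Fin 8) ℂ := X 1
noncomputable abbrev h₁ : MvPolynomial (Fin 8) ℂ := X 2
noncomputable abbrev y₂ : MvPolynomial (Fin 8) ℂ := X 3
noncomputable abbrev y₃ : MvPolynomial (Fin 8) ℂ := X 4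
noncomputable abbrev x₂ : MvPolynomial (Fin 8) ℂ := X 5
noncomputable abbrev x₃ : MvPolynomial (Fin 8) ℂ := X 6
noncomputable abbrev h₀ : MvPolynomial (Fin 8) ℂ := X 7

noncomputable def I₁ : MvPolynomial (Fin 8) ℂ := h₀
noncomputable def I₂ : MvPolynomial (Fin 8) ℂ := h₁ ^ 2 + 4 * (x₁ * y₁)
noncomputable def I₃ : MvPolynomial (Fin 8) ℂ := x₂ * y₂ + x₃ * y₃
noncomputable def I₄ : MvPolynomial (Fin 8) ℂ := h₁ * (y₂ * y₃) + y₁ * y₂ ^ 2 - x₁ * y₃ ^ 2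
noncomputable def I₅ : MvPolynomial (Fin 8) ℂ := h₁ * (x₂ * x₃) + x₁ * x₂ ^ 2 - x₃ ^ 2 * y₁
noncomputable def I₆ : MvPolynomial (Fin 8) ℂ :=
  h₁ * (x₂ * y₂ - x₃ * y₃) - 2 * (y₁ * y₂ * x₃ + x₁ * x₂ * y₃)

/-- The square of `I₆` in terms of the primary invariants, as a polynomial in five variables. -/
noncomputable def discr : MvPolynomial (Fin 5) ℂ := X 1 * X 2 ^ 2 - 4 * (X 3 * X 4)

lemma I₆_sq : I₆ ^ 2 = aeval ![I₁, I₂, I₃, I₄, I₅] discr := by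
  simp only [discr, I₂, I₃, I₄, I₅, I₆, map_sub, map_mul, map_pow, aeval_X, map_ofNat,
    Matrix.cons_val]
  ring

lemma discr_ne_zero : discr ≠ 0 := by
  intro h
  have := congrArg (eval ![0, 1, 1, 0, 0]) h
  simp [discr] at this

/-- Every value of `(I₁, …, I₅)` with `I₅ ≠ 0`, together with either square root of `discr`, is
attained by the invariants at some point. -/
lemma exists_eval_invariants_eq (a : Fin 5 → ℂ) (ha : a 4 ≠ 0) {s : ℂ}
    (hs : s ^ 2 = eval a discr) :
    ∃ v : Fin 8 → ℂ, (∀ p, eval v (aeval ![I₁, I₂, I₃, I₄, I₅] p) = eval a p) ∧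
      eval v I₆ = s := by
  obtain ⟨h, hh⟩ := IsAlgClosed.exists_pow_nat_eq (a 1) two_pos
  simp only [discr, map_sub, map_mul, map_pow, eval_X, map_ofNat] at hs
  refine ⟨![0, a 4, h, a 2, (h * a 2 - s) / (2 * a 4), 1, 0, a 0], fun p => ?_, ?_⟩
  · have key : (eval ![0, a 4, h, a 2, (h * a 2 - s) / (2 * a 4), 1, 0, a 0]).comp
        (aeval (R := ℂ) ![I₁, I₂, I₃, I₄, I₅]).toRingHom = eval a := by
      refine MvPolynomial.ringHom_ext (fun c => by simp) (fun i => ?_)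
      fin_cases i
      · simp [I₁]
      · simp [I₂, hh]
      · simp [I₃]
      · simp [I₄]
        field_simp
        linear_combination a 2 ^ 2 * hh - hs
      · simp [I₅]
    exact RingHom.congr_fun key p
  · simp [I₆]
    field_simp
    ring

lemma eq_zero_of_aeval_add_I₆_mul_aeval_eq_zero {p q : MvPolynomial (Fin 5) ℂ}
    (h : aeval ![I₁, I₂, I₃, I₄, I₅] p + I₆ * aeval ![I₁, I₂, I₃, I₄, I₅] q = 0) :
    p = 0 ∧ q = 0 := by
  have key (a : Fin 5 → ℂ) (ha : a 4 ≠ 0) : eval a p = 0 ∧ eval a discr * eval a q = 0 := by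
    obtain ⟨s, hs⟩ := IsAlgClosed.exists_pow_nat_eq (eval a discr) two_pos
    have root {t : ℂ} (ht : t ^ 2 = eval a discr) : eval a p + t * eval a q = 0 := by
      obtain ⟨v, hv, hv₆⟩ := exists_eval_invariants_eq a ha ht
      rw [← hv, ← hv, ← hv₆, ← map_mul, ← map_add, h, map_zero]
    have hpos := root hs
    have hneg := root (t := -s) (by rw [neg_sq, hs])
    constructor
    · linear_combination (hpos + hneg) / 2
    · rw [← hs]
      linear_combination s * (hpos - hneg) / 2
  have hp : X 4 * p = 0 := MvPolynomial.funext fun a => by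
    by_cases ha : a 4 = 0
    · simp [ha]
    · simp [(key a ha).1]
  have hq : X 4 * (discr * q) = 0 := MvPolynomial.funext fun a => by
    by_cases ha : a 4 = 0
    · simp [ha]
    · rw [map_mul, map_mul, (key a ha).2, mul_zero, map_zero]
  simpa [discr_ne_zero, X_ne_zero] using And.intro hp hq

lemma exists_eq_aeval_add_I₆_mul_aeval {r : MvPolynomial (Fin 8) ℂ}
    (hr : r ∈ Algebra.adjoin ℂ ({I₁, I₂, I₃, I₄, I₅, I₆} : Set (MvPolynomial (Fin 8) ℂ))) :
    ∃ p q : MvPolynomial (Fin 5) ℂ,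
      r = aeval ![I₁, I₂, I₃, I₄, I₅] p + I₆ * aeval ![I₁, I₂, I₃, I₄, I₅] q := by
  induction hr using Algebra.adjoin_induction with
  | mem x hx =>
    rcases hx with rfl | rfl | rfl | rfl | rfl | rfl
    · exact ⟨X 0, 0, by simp⟩
    · exact ⟨X 1, 0, by simp⟩
    · exact ⟨X 2, 0, by simp⟩
    · exact ⟨X 3, 0, by simp⟩
    · exact ⟨X 4, 0, by simp⟩
    · exact ⟨0, 1, by simp⟩
  | algebraMap c => exact ⟨C c, 0, by simp [algebraMap_eq]⟩
  | add x y _ _ hx hy =>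
    obtain ⟨p, q, rfl⟩ := hx
    obtain ⟨p', q', rfl⟩ := hy
    exact ⟨p + p', q + q', by simp only [map_add]; ring⟩
  | mul x y _ _ hx hy =>
    obtain ⟨p, q, rfl⟩ := hx
    obtain ⟨p', q', rfl⟩ := hy
    refine ⟨p * p' + discr * (q * q'), p * q' + q * p', ?_⟩
    simp only [map_add, map_mul, ← I₆_sq]
    ring

/-- The Hironaka decomposition `R = ℂ[I₁,…,I₅] ⊕ I₆·ℂ[I₁,…,I₅]`: every element of the
subalgebra `R = ℂ[I₁,…,I₆]` is uniquely of the form `p(I₁,…,I₅) + I₆·q(I₁,…,I₅)`. -/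
theorem hironaka_decomposition (r : MvPolynomial (Fin 8) ℂ)
    (hr : r ∈ Algebra.adjoin ℂ ({I₁, I₂, I₃, I₄, I₅, I₆} : Set (MvPolynomial (Fin 8) ℂ))) :
    ∃! pq : MvPolynomial (Fin 5) ℂ × MvPolynomial (Fin 5) ℂ,
      r = aeval ![I₁, I₂, I₃, I₄, I₅] pq.1 + I₆ * aeval ![I₁, I₂, I₃, I₄, I₅] pq.2 := by
  obtain ⟨p, q, h⟩ := exists_eq_aeval_add_I₆_mul_aeval hr
  refine ⟨(p, q), h, fun ⟨p', q'⟩ h' => ?_⟩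
  obtain ⟨hp, hq⟩ := eq_zero_of_aeval_add_I₆_mul_aeval_eq_zero (p := p' - p) (q := q' - q) (by
    simp only [map_sub]
    linear_combination h - h')
  rw [sub_eq_zero.mp hp, sub_eq_zero.mp hq]
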